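/- Fix E < 0, let d be a positive integer, and define u : ℤ^d → ℝ by u(x) = (2π)^{−d} ∫_{[−π,π]^d} (4 Σ_{j=1}^d sin²(ξ_j/2) + |E|)^{−1} e^{−i⟨x,ξ⟩} dξ. Let Ω ⊂ ℝ^d be a bounded set containing 0 and set ρ_Ω(x) = sup_{ξ ∈ Ω} ⟨x, ξ⟩. If there exists C > 0 such that |u(x)| ≤ C e^{−ρ_Ω(x)} for all x ∈ ℤ^d, then Ω ⊂ K^E = {ξ ∈ ℝ^d : 4 Σ_{j=1}^d sinh²(ξ_j/2) ≤ |E|}. -/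

import Mathlib

open MeasureTheory Real

noncomputable section

/-- The fundamental solution
`u(x) = (2π)^{−d} ∫_{[−π,π]^d} (4 Σ_j sin²(ξ_j/2) + |E|)^{−1} e^{−i⟨x,ξ⟩} dξ`
(a real number; the integral is real by symmetry). -/
def ufun (d : ℕ) (E : ℝ) (x : Fin d → ℤ) : ℝ :=
  (((2 * π) ^ d)⁻¹ *
    ∫ ξ in Set.univ.pi (fun _ : Fin d => Set.Icc (-π) π),
      (((4 * ∑ j, Real.sin (ξ j / 2) ^ 2 + |E|)⁻¹ : ℝ) : ℂ) *
        Complex.exp (-Complex.I * ((∑ j, (x j : ℝ) * ξ j : ℝ) : ℂ))).re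

lemma nnn_summable (r : ℝ) (hr0 : 0 ≤ r) (hr1 : r < 1) (d : ℕ) :
    Summable (fun x : Fin d → ℤ => r ^ (∑ j, (x j).natAbs)) := by
  have h1 : Summable (fun n : ℤ => r ^ n.natAbs) := by
    apply Summable.of_nat_of_neg
    · simpa using summable_geometric_of_lt_one hr0 hr1
    · simpa using summable_geometric_of_lt_one hr0 hr1
  induction d with
  | zero => exact Summable.of_finite
  | succ k ih =>
    rw [← (Fin.consEquiv (fun _ : Fin (k+1) => ℤ)).summable_iff]
    have := Summable.mul_of_nonneg h1 ih (fun _ => by positivity) (fun _ => by positivity)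
    refine this.congr ?_
    intro p
    simp [Fin.consEquiv, Fin.sum_univ_succ, pow_add]

/-- the plane wave -/
def pw (d : ℕ) (x : Fin d → ℤ) (ξ : Fin d → ℝ) : ℂ :=
  Complex.exp (-Complex.I * ((∑ j, (x j : ℝ) * ξ j : ℝ) : ℂ))

/-- the symbol -/
def sy (d : ℕ) (E : ℝ) (ξ : Fin d → ℝ) : ℝ := 4 * ∑ j, Real.sin (ξ j / 2) ^ 2 + |E|

/-- the cube -/
def cube (d : ℕ) : Set (Fin d → ℝ) := Set.univ.pi (fun _ : Fin d => Set.Icc (-π) π)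

lemma cube_compact (d : ℕ) : IsCompact (cube d) := isCompact_univ_pi (fun _ => isCompact_Icc)

lemma sy_pos (d : ℕ) (E : ℝ) (hE : E < 0) (ξ : Fin d → ℝ) : |E| ≤ sy d E ξ := by
  unfold sy
  have : 0 ≤ ∑ j, Real.sin (ξ j / 2) ^ 2 := by positivity
  linarith

lemma int_cont (d : ℕ) (E : ℝ) (hE : E < 0) (x : Fin d → ℤ) :
    Continuous (fun ξ : Fin d → ℝ => (((sy d E ξ)⁻¹ : ℝ) : ℂ) * pw d x ξ) := by
  refine Continuous.mul (Complex.continuous_ofReal.comp (Continuous.inv₀ ?_ ?_)) ?_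
  · unfold sy; fun_prop
  · intro ξ
    have := sy_pos d E hE ξ
    have := abs_pos.mpr hE.ne
    linarith
  · unfold pw; fun_prop

/-- the integral -/
def Iu (d : ℕ) (E : ℝ) (x : Fin d → ℤ) : ℂ :=
  ∫ ξ in cube d, (((sy d E ξ)⁻¹ : ℝ) : ℂ) * pw d x ξ

lemma ufun_eq (d : ℕ) (E : ℝ) (x : Fin d → ℤ) :
    ufun d E x = ((2 * π) ^ d)⁻¹ * (Iu d E x).re := by
  have : ufun d E x = ((((2 * π) ^ d)⁻¹ : ℝ) * Iu d E x).re := by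
    unfold ufun Iu cube pw sy
    push_cast
    rfl
  rw [this, Complex.re_ofReal_mul]

lemma pw_add (d : ℕ) (x y : Fin d → ℤ) (ξ : Fin d → ℝ) :
    pw d (x + y) ξ = pw d x ξ * pw d y ξ := by
  unfold pw
  rw [← Complex.exp_add]
  congr 1
  simp [add_mul, Finset.sum_add_distrib, mul_add]

lemma pw_norm (d : ℕ) (x : Fin d → ℤ) (ξ : Fin d → ℝ) : ‖pw d x ξ‖ = 1 := by
  unfold pw
  rw [Complex.norm_exp]
  simp

lemma pw_single (d : ℕ) (j : Fin d) (ξ : Fin d → ℝ) :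
    pw d (Pi.single j 1) ξ + pw d (-Pi.single j 1) ξ = ((2 - 4 * Real.sin (ξ j / 2) ^ 2 : ℝ) : ℂ) := by
  have h1 : (∑ i, ((Pi.single j (1 : ℤ) : Fin d → ℤ) i : ℝ) * ξ i) = ξ j := by
    rw [Finset.sum_eq_single j] <;> simp +contextual
  have h2 : (∑ i, ((-Pi.single j (1 : ℤ) : Fin d → ℤ) i : ℝ) * ξ i) = -ξ j := by
    rw [Finset.sum_eq_single j] <;> simp +contextual
  unfold pw
  rw [h1, h2]
  have h3 : (2 - 4 * Real.sin (ξ j / 2) ^ 2 : ℝ) = 2 * Real.cos (ξ j) := by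
    have := Real.cos_two_mul (ξ j / 2)
    have h4 := Real.sin_sq_add_cos_sq (ξ j / 2)
    rw [mul_div_cancel₀ _ two_ne_zero] at this
    rw [this]; linarith
  rw [h3]
  push_cast
  rw [Complex.two_cos, add_comm]
  congr 1 <;> congr 1 <;> ring

lemma pw_int (d : ℕ) (x : Fin d → ℤ) :
    ∫ ξ in cube d, pw d x ξ = if x = 0 then ((2 * π) ^ d : ℂ) else 0 := by
  have h1 : ∀ ξ, pw d x ξ = ∏ j, Complex.exp (-Complex.I * ((x j : ℝ) * ξ j : ℝ)) := by
    intro ξ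
    unfold pw
    rw [← Complex.exp_sum]
    congr 1
    push_cast
    rw [Finset.mul_sum]
  have h2 : ∀ n : ℤ, ∫ t in Set.Icc (-π) π, Complex.exp (-Complex.I * ((n : ℝ) * t : ℝ))
      = if n = 0 then (2 * π : ℂ) else 0 := by
    intro n
    rw [integral_Icc_eq_integral_Ioc, ← intervalIntegral.integral_of_le (by linarith [Real.pi_pos])]
    split_ifs with hn
    · subst hn
      simp
      ring
    · have hc : (-Complex.I * n) ≠ 0 := by simp [hn]
      have := integral_exp_mul_complex (a := -π) (b := π) hc
      have h3 : ∀ t : ℝ, (-Complex.I * ((n : ℝ) * t : ℝ)) = (-Complex.I * n) * t := by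
        intro t; push_cast; ring
      simp_rw [h3]
      rw [this]
      have h4 : Complex.exp (-Complex.I * n * (π : ℝ)) = Complex.exp (-Complex.I * n * ((-π : ℝ) : ℂ)) := by
        rw [Complex.exp_eq_exp_iff_exists_int]
        refine ⟨-n, ?_⟩
        push_cast; ring
      rw [h4]; simp
  simp_rw [h1]
  unfold cube
  rw [volume_pi, Measure.restrict_pi_pi,
    integral_fintype_prod_eq_prod (𝕜 := ℂ) (fun j (t : ℝ) => Complex.exp (-Complex.I * ((x j : ℝ) * t : ℝ)))]
  simp_rw [h2]
  split_ifs with hx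
  · subst hx; simp
  · obtain ⟨j, hj⟩ := Function.ne_iff.mp hx
    exact Finset.prod_eq_zero (Finset.mem_univ j) (if_neg hj)

lemma Iu_eq (d : ℕ) (E : ℝ) (hE : E < 0) (x : Fin d → ℤ) :
    (2 * d + |E| : ℝ) * Iu d E x
      - ∑ j, (Iu d E (x + Pi.single j 1) + Iu d E (x + -Pi.single j 1))
      = if x = 0 then ((2 * π) ^ d : ℂ) else 0 := by
  rw [← pw_int]
  have hi : ∀ x, Integrable (fun ξ : Fin d → ℝ => (((sy d E ξ)⁻¹ : ℝ) : ℂ) * pw d x ξ)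
      (volume.restrict (cube d)) := fun x =>
    (int_cont d E hE x).continuousOn.integrableOn_compact (cube_compact d)
  have hi2 : ∀ j : Fin d, Integrable (fun ξ : Fin d → ℝ =>
      (((sy d E ξ)⁻¹ : ℝ) : ℂ) * pw d (x + Pi.single j 1) ξ
        + (((sy d E ξ)⁻¹ : ℝ) : ℂ) * pw d (x + -Pi.single j 1) ξ)
      (volume.restrict (cube d)) := fun j => (hi _).add (hi _)
  unfold Iu
  simp_rw [← integral_add (hi _) (hi _)]
  rw [← integral_finsetSum _ (fun j _ => hi2 j), ← integral_const_mul,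
    ← integral_sub ((hi _).const_mul _) (integrable_finsetSum _ (fun j _ => hi2 j))]
  congr 1
  ext ξ
  simp_rw [pw_add, ← mul_add, pw_single]
  rw [← Finset.mul_sum, ← Finset.mul_sum]
  have h0 : sy d E ξ ≠ 0 := by
    have := sy_pos d E hE ξ
    have := abs_pos.mpr hE.ne
    linarith
  have h1 : (2 * d + |E| : ℝ) - ∑ j, (2 - 4 * Real.sin (ξ j / 2) ^ 2 : ℝ) = sy d E ξ := by
    unfold sy
    rw [Finset.sum_sub_distrib, ← Finset.mul_sum]
    simp
    ring
  rw [← Complex.ofReal_sum]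
  have h2 : ∀ a b s p : ℂ, a * (s * p) - s * (p * b) = ((a - b) * s) * p := by intros; ring
  rw [h2, ← Complex.ofReal_sub, h1, ← Complex.ofReal_mul, mul_inv_cancel₀ h0]
  simp

lemma u_eq (d : ℕ) (E : ℝ) (hE : E < 0) (x : Fin d → ℤ) :
    (2 * d + |E|) * ufun d E x
      - ∑ j, (ufun d E (x + Pi.single j 1) + ufun d E (x + -Pi.single j 1))
      = if x = 0 then 1 else 0 := by
  have h := congrArg Complex.re (Iu_eq d E hE x)
  rw [Complex.sub_re, Complex.re_ofReal_mul, Complex.re_sum] at h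
  simp_rw [Complex.add_re] at h
  simp_rw [ufun_eq, ← mul_add]
  rw [← Finset.mul_sum]
  have h2 : ∀ a b s p : ℝ, a * (s * p) - s * b = s * (a * p - b) := by intros; ring
  rw [h2, h]
  have hp : ((2 * π) ^ d : ℝ) ≠ 0 := by positivity
  split_ifs
  · have : ((2 * π) ^ d : ℂ) = (((2 * π) ^ d : ℝ) : ℂ) := by push_cast; rfl
    rw [this, Complex.ofReal_re, inv_mul_cancel₀ hp]
  · simp

lemma u_bdd (d : ℕ) (E : ℝ) (hE : E < 0) : ∃ M, 0 ≤ M ∧ ∀ x, |ufun d E x| ≤ M := by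
  refine ⟨|((2 * π) ^ d)⁻¹| * (|E|⁻¹ * volume.real (cube d)), by positivity, fun x => ?_⟩
  rw [ufun_eq, abs_mul]
  refine mul_le_mul_of_nonneg_left ((Complex.abs_re_le_norm _).trans ?_) (abs_nonneg _)
  refine norm_setIntegral_le_of_norm_le_const (cube_compact d).measure_lt_top ?_
  intro ξ _
  rw [norm_mul, pw_norm, mul_one, Complex.norm_real, Real.norm_eq_abs]
  have h := sy_pos d E hE ξ
  have h0 := abs_pos.mpr hE.ne
  rw [abs_of_nonneg (inv_nonneg.mpr (h0.le.trans h))]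
  exact inv_anti₀ h0 h

lemma natAbs_single (d : ℕ) (x : Fin d → ℤ) (j : Fin d) (s : ℤ) (hs : s.natAbs = 1) :
    ∑ i, (x i).natAbs ≤ ∑ i, ((x + (Pi.single j s : Fin d → ℤ)) i).natAbs + 1 := by
  have : ∑ i, ((Pi.single j s : Fin d → ℤ) i).natAbs = 1 := by
    rw [Finset.sum_eq_single j] <;> simp +contextual [hs]
  rw [← this, ← Finset.sum_add_distrib]
  refine Finset.sum_le_sum fun i _ => ?_
  simp only [Pi.add_apply]
  omega

lemma u_decay (d : ℕ) (E : ℝ) (hE : E < 0) (M : ℝ) (hM : ∀ x, |ufun d E x| ≤ M) (n : ℕ) :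
    ∀ x : Fin d → ℤ, n ≤ ∑ j, (x j).natAbs →
      |ufun d E x| ≤ M * (2 * d / (2 * d + |E|)) ^ n := by
  have h0 := abs_pos.mpr hE.ne
  induction n with
  | zero => intro x _; simpa using hM x
  | succ n ih =>
    intro x hx
    have hx0 : x ≠ 0 := by rintro rfl; simp at hx
    have h := u_eq d E hE x
    rw [if_neg hx0, sub_eq_zero] at h
    have hD : (0 : ℝ) < 2 * d + |E| := by positivity
    have h2 : (2 * d + |E|) * |ufun d E x| ≤ 2 * d * (M * (2 * d / (2 * d + |E|)) ^ n) := by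
      rw [← abs_of_pos hD, ← abs_mul, abs_of_pos hD, h]
      refine (Finset.abs_sum_le_sum_abs _ _).trans ?_
      have : ∀ j ∈ Finset.univ, |ufun d E (x + Pi.single j 1) + ufun d E (x + -Pi.single j 1)|
          ≤ 2 * (M * (2 * d / (2 * d + |E|)) ^ n) := by
        intro j _
        refine (abs_add_le _ _).trans ?_
        have a1 := natAbs_single d x j 1 rfl
        have a2 := natAbs_single d x j (-1) rfl
        rw [Pi.single_neg] at a2
        have := ih (x + Pi.single j 1) (by omega)
        have := ih (x + -Pi.single j 1) (by omega)
        linarith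
      refine (Finset.sum_le_sum this).trans (le_of_eq ?_)
      simp
      ring
    rw [← le_div_iff₀' hD] at h2
    refine h2.trans (le_of_eq ?_)
    rw [pow_succ]; ring

lemma u_summable_contra (d : ℕ) (E : ℝ) (hE : E < 0) (a : Fin d → ℝ)
    (ha : 4 * ∑ j, Real.sinh (a j / 2) ^ 2 = |E|)
    (hs : Summable (fun x : Fin d → ℤ => ufun d E x * Real.exp (∑ j, (x j : ℝ) * a j))) : False := by
  set f := (fun x : Fin d → ℤ => ufun d E x * Real.exp (∑ j, (x j : ℝ) * a j)) with hf
  have key : ∀ y : Fin d → ℤ, HasSum (fun x : Fin d → ℤ =>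
      ufun d E (x + y) * Real.exp (∑ j, (x j : ℝ) * a j))
      (Real.exp (-∑ j, (y j : ℝ) * a j) * ∑' x, f x) := by
    intro y
    have h := ((Equiv.addRight y).hasSum_iff.mpr hs.hasSum).mul_left
      (Real.exp (-∑ j, (y j : ℝ) * a j))
    refine h.congr_fun ?_ |> id
    intro x
    simp only [hf, Function.comp, Equiv.coe_addRight, Pi.add_apply]
    rw [mul_left_comm, ← Real.exp_add]
    congr 2
    push_cast
    simp only [add_mul, Finset.sum_add_distrib]
    ring
  have h1 : ∀ j, (∑ i, ((Pi.single j (1 : ℤ) : Fin d → ℤ) i : ℝ) * a i) = a j := by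
    intro j
    rw [Finset.sum_eq_single j] <;> simp +contextual
  have h2 : ∀ j, (∑ i, ((-Pi.single j (1 : ℤ) : Fin d → ℤ) i : ℝ) * a i) = -a j := by
    intro j
    rw [Finset.sum_eq_single j] <;> simp +contextual
  have H := (hs.hasSum.mul_left (2 * d + |E|)).sub (hasSum_sum (s := Finset.univ)
    (fun j _ => (key (Pi.single j 1)).add (key (-Pi.single j 1))))
  simp only [h1, h2] at H
  have H2 : HasSum (fun x : Fin d → ℤ => if x = 0 then (1 : ℝ) else 0) 1 := hasSum_ite_eq 0 1
  have H3 : (fun x : Fin d → ℤ => if x = 0 then (1 : ℝ) else 0) = fun x =>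
      (2 * d + |E|) * f x - ∑ j, (ufun d E (x + Pi.single j 1) * Real.exp (∑ j, (x j : ℝ) * a j)
        + ufun d E (x + -Pi.single j 1) * Real.exp (∑ j, (x j : ℝ) * a j)) := by
    funext x
    simp_rw [← add_mul]
    rw [← Finset.sum_mul, hf, ← mul_assoc, ← sub_mul, u_eq d E hE x]
    split_ifs with hx
    · subst hx; simp
    · simp
  rw [H3] at H2
  have H4 := H.unique H2
  have h5 : ∀ j, Real.exp (-a j) + Real.exp (- -a j) = 2 + 4 * Real.sinh (a j / 2) ^ 2 := by
    intro j
    have c := Real.cosh_two_mul (a j / 2)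
    have c2 := Real.cosh_sq (a j / 2)
    rw [mul_div_cancel₀ _ two_ne_zero, Real.cosh_eq] at c
    rw [neg_neg]
    linarith
  simp_rw [← add_mul, h5] at H4
  rw [← Finset.sum_mul, Finset.sum_add_distrib, ← Finset.mul_sum, ha] at H4
  simp at H4
  apply zero_ne_one (α := ℝ)
  rw [← H4]
  ring

/-- optimality of the Agmon decay rate: if `Ω ∋ 0` is bounded and
`|u(x)| ≤ C e^{−ρ_Ω(x)}` on `ℤ^d` with `ρ_Ω(x) = sup_{ξ ∈ Ω} ⟨x,ξ⟩`, then
`Ω ⊆ K^E = {ξ : 4 Σ_j sinh²(ξ_j/2) ≤ |E|}`. -/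
theorem decay_optimality (d : ℕ) (hd : 0 < d) (E : ℝ) (hE : E < 0)
    (Ω : Set (EuclideanSpace ℝ (Fin d))) (hΩb : Bornology.IsBounded Ω)
    (h0Ω : (0 : EuclideanSpace ℝ (Fin d)) ∈ Ω)
    (C : ℝ) (hC : 0 < C)
    (hdec : ∀ x : Fin d → ℤ, |ufun d E x| ≤
      C * Real.exp (-sSup {r | ∃ ξ ∈ Ω, r = ∑ j, (x j : ℝ) * ξ j})) :
    Ω ⊆ {ξ : EuclideanSpace ℝ (Fin d) | 4 * ∑ j, Real.sinh (ξ j / 2) ^ 2 ≤ |E|} := by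
  intro η hη
  by_contra hcon
  simp only [Set.mem_setOf_eq, not_le] at hcon
  have h0 := abs_pos.mpr hE.ne
  obtain ⟨z, ⟨hz0, hz1⟩, hz⟩ : |E| ∈ (fun t : ℝ => 4 * ∑ j, Real.sinh (t * η j / 2) ^ 2) '' Set.Ioo 0 1 := by
    apply intermediate_value_Ioo (zero_le_one)
    · fun_prop
    · simpa [h0] using hcon
  obtain ⟨M, hM0, hM⟩ := u_bdd d E hE
  have hdp : (0 : ℝ) < d := by exact_mod_cast hd
  set q : ℝ := 2 * d / (2 * d + |E|) with hq
  have hq0 : 0 ≤ q := by positivity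
  have hq1 : q < 1 := by rw [hq, div_lt_one (by positivity)]; linarith
  apply u_summable_contra d E hE (fun j => z * η j) hz
  have hS := (nnn_summable (q ^ (1 - z)) (by positivity)
    (Real.rpow_lt_one hq0 hq1 (by linarith)) d).mul_left (C ^ z * M ^ (1 - z))
  refine Summable.of_norm_bounded hS fun x => ?_
  rw [norm_mul, Real.norm_eq_abs, Real.norm_eq_abs, Real.abs_exp]
  set s := ∑ j, (x j : ℝ) * η j with hs
  have hsz : ∑ j, (x j : ℝ) * (z * η j) = z * s := by
    rw [hs, Finset.mul_sum]; exact Finset.sum_congr rfl fun _ _ => by ring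
  rw [hsz]
  have hbdd : BddAbove {r | ∃ ξ ∈ Ω, r = ∑ j, (x j : ℝ) * ξ j} := by
    obtain ⟨R, hR⟩ := hΩb.exists_norm_le
    refine ⟨∑ j, |(x j : ℝ)| * R, ?_⟩
    rintro r ⟨ξ, hξ, rfl⟩
    refine Finset.sum_le_sum fun j _ => (le_abs_self _).trans ?_
    rw [abs_mul]
    exact mul_le_mul_of_nonneg_left ((PiLp.norm_apply_le ξ j).trans (hR ξ hξ)) (abs_nonneg _)
  have hsup := le_csSup hbdd ⟨η, hη, hs⟩
  have hu1 : |ufun d E x| ≤ C * Real.exp (-s) :=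
    (hdec x).trans (mul_le_mul_of_nonneg_left (Real.exp_le_exp.mpr (by linarith)) hC.le)
  have hu2 := u_decay d E hE M hM _ x le_rfl
  rw [← hq] at hu2
  set n := ∑ j, (x j).natAbs
  have e1 : |ufun d E x| ^ z ≤ C ^ z * Real.exp (-(z * s)) := by
    refine (Real.rpow_le_rpow (abs_nonneg _) hu1 hz0.le).trans (le_of_eq ?_)
    rw [Real.mul_rpow hC.le (Real.exp_pos _).le, ← Real.exp_mul]
    congr 2; ring
  have e2 : |ufun d E x| ^ (1 - z) ≤ M ^ (1 - z) * (q ^ (1 - z)) ^ n := by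
    refine (Real.rpow_le_rpow (abs_nonneg _) hu2 (by linarith)).trans (le_of_eq ?_)
    rw [Real.mul_rpow hM0 (by positivity), ← Real.rpow_natCast, ← Real.rpow_natCast,
      ← Real.rpow_mul hq0, ← Real.rpow_mul hq0, mul_comm (1 - z)]
  have e3 : |ufun d E x| = |ufun d E x| ^ z * |ufun d E x| ^ (1 - z) := by
    rw [← Real.rpow_add' (abs_nonneg _) (by simp)]
    simp
  rw [e3]
  calc _ ≤ (C ^ z * Real.exp (-(z * s))) * (M ^ (1 - z) * (q ^ (1 - z)) ^ n) * Real.exp (z * s) := by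
        gcongr
    _ = (C ^ z * M ^ (1 - z) * (q ^ (1 - z)) ^ n) * (Real.exp (-(z * s)) * Real.exp (z * s)) := by ring
    _ = _ := by rw [← Real.exp_add]; simp

end
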